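/- Let j ≥ 0 and let A, B, C be three j-dimensional isotropic subspaces of V = F₂^j × F₂^j with respect to the hyperbolic form Q, satisfying the no-twist condition. If moreover the pairwise intersections are trivial, A ∩ B = B ∩ C = C ∩ A = 0, then j is even. -/

import Mathlib

/-- The hyperbolic bilinear form `Q` on `V = F₂^j × F₂^j`:
`Q((x,y),(x',y')) = Σᵢ xᵢ y'ᵢ + Σᵢ yᵢ x'ᵢ`. -/
def hyperbolicForm (j : ℕ) (u w : (Fin j → ZMod 2) × (Fin j → ZMod 2)) : ZMod 2 :=
  (∑ i, u.1 i * w.2 i) + ∑ i, u.2 i * w.1 i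

theorem even_finrank_of_alt {K W : Type*} [Field K] [AddCommGroup W] [Module K W]
    [FiniteDimensional K W] (β : LinearMap.BilinForm K W) (halt : ∀ x, β x x = 0)
    (hnd : β.Nondegenerate) : Even (Module.finrank K W) := by
  have hA : β.IsAlt := halt
  obtain ⟨L, hL, hmax⟩ := WellFounded.has_min (wellFounded_gt (α := Submodule K W))
    {L | L ≤ β.orthogonal L} ⟨⊥, (bot_le : ⊥ ≤ β.orthogonal ⊥)⟩
  have hL' : ∀ x ∈ L, ∀ y ∈ L, β x y = 0 := fun x hx y hy =>
    (LinearMap.BilinForm.mem_orthogonal_iff.1 (hL hy)) x hx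
  have heq : β.orthogonal L = L := by
    refine le_antisymm ?_ hL
    intro x hx
    have hx' : ∀ y ∈ L, β y x = 0 := fun y hy =>
      (LinearMap.BilinForm.mem_orthogonal_iff.1 hx) y hy
    by_contra hxL
    refine hmax (L ⊔ Submodule.span K {x}) ?_ ?_
    · intro u hu
      rw [LinearMap.BilinForm.mem_orthogonal_iff]
      intro v hv
      obtain ⟨l, hl, s, hs, rfl⟩ := Submodule.mem_sup.1 hu
      obtain ⟨m, hm, t, ht, rfl⟩ := Submodule.mem_sup.1 hv
      obtain ⟨a, rfl⟩ := Submodule.mem_span_singleton.1 hs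
      obtain ⟨b, rfl⟩ := Submodule.mem_span_singleton.1 ht
      have h1 : β x l = 0 := (hA.isRefl l x (hx' l hl))
      show β _ _ = 0
      simp [hL' m hm l hl, hx' m hm, h1, halt]
    · refine lt_of_le_of_ne le_sup_left ?_
      intro h
      apply hxL
      rw [h]
      exact Submodule.mem_sup_right (Submodule.mem_span_singleton_self x)
  have := LinearMap.BilinForm.finrank_orthogonal hnd L
  rw [heq] at this
  have h2 := Submodule.finrank_le L
  exact ⟨Module.finrank K L, by omega⟩

/-- The hyperbolic form as a bilinear map. -/
def hypBilin (j : ℕ) : LinearMap.BilinForm (ZMod 2) ((Fin j → ZMod 2) × (Fin j → ZMod 2)) :=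
  LinearMap.mk₂ (ZMod 2) (hyperbolicForm j)
    (by intros; simp [hyperbolicForm, add_mul, Finset.sum_add_distrib]; ring)
    (by intros; simp [hyperbolicForm, Finset.mul_sum, mul_add, mul_assoc])
    (by intros; simp [hyperbolicForm, mul_add, Finset.sum_add_distrib]; ring)
    (by intros; simp [hyperbolicForm, Finset.mul_sum, mul_add, mul_left_comm])

theorem hypBilin_left (j : ℕ) (u : (Fin j → ZMod 2) × (Fin j → ZMod 2))
    (h : ∀ w, hypBilin j u w = 0) : u = 0 := by
  ext i
  · simpa [hypBilin, hyperbolicForm, Pi.single_apply] using h (0, Pi.single i 1)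
  · simpa [hypBilin, hyperbolicForm, Pi.single_apply] using h (Pi.single i 1, 0)


/-- If `A`, `B`, `C` are three `j`-dimensional (maximal) isotropic subspaces of
`F₂^j × F₂^j` for the hyperbolic form `Q`, satisfying the no-twist condition, and
the pairwise intersections are trivial, then `j` is even. -/
theorem even_of_trivial_intersections (j : ℕ)
    (A B C : Submodule (ZMod 2) ((Fin j → ZMod 2) × (Fin j → ZMod 2)))
    (hAdim : Module.finrank (ZMod 2) A = j)
    (hBdim : Module.finrank (ZMod 2) B = j)
    (hCdim : Module.finrank (ZMod 2) C = j)
    (hAiso : ∀ u ∈ A, ∀ w ∈ A, hyperbolicForm j u w = 0)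
    (hBiso : ∀ u ∈ B, ∀ w ∈ B, hyperbolicForm j u w = 0)
    (hCiso : ∀ u ∈ C, ∀ w ∈ C, hyperbolicForm j u w = 0)
    (hnt : ∀ a ∈ A, ∀ b ∈ B, ∀ c ∈ C, a + b + c = 0 → hyperbolicForm j a b = 0)
    (hAB : A ⊓ B = ⊥) (hBC : B ⊓ C = ⊥) (hCA : C ⊓ A = ⊥) :
    Even j := by

  have hcompl : IsCompl A B := by
    have hd : Disjoint A B := disjoint_iff.2 hAB
    refine ⟨hd, ?_⟩
    rw [codisjoint_iff]
    apply Submodule.eq_top_of_finrank_eq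
    have := Submodule.finrank_sup_add_finrank_inf_eq A B
    rw [hAB] at this
    simp at this
    simp [this, hAdim, hBdim]
  have hdec : ∀ v, ((A.projectionOnto B hcompl v : A) : (Fin j → ZMod 2) × (Fin j → ZMod 2))
      + (B.projectionOnto A hcompl.symm v : B) = v := fun v =>
    Submodule.projection_add_projection_eq_self hcompl v
  set pa := (A.projectionOnto B hcompl).comp C.subtype with hpa
  set pb := (B.projectionOnto A hcompl.symm).comp C.subtype with hpb
  have hdec' : ∀ c : C, (pa c : (Fin j → ZMod 2) × (Fin j → ZMod 2)) + pb c = c := fun c => hdec c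
  have hsurj : Function.Surjective pb := by
    rw [← LinearMap.injective_iff_surjective_of_finrank_eq_finrank (by rw [hBdim, hCdim]),
      injective_iff_map_eq_zero]
    intro c hc
    have h1 := hdec' c
    rw [hc] at h1
    have h2 : (c : (Fin j → ZMod 2) × (Fin j → ZMod 2)) ∈ C ⊓ A := by
      refine ⟨c.2, ?_⟩
      rw [← h1]; simp
    rw [hCA] at h2
    simpa using h2
  let β : LinearMap.BilinForm (ZMod 2) C :=
    (hypBilin j).compl₁₂ (A.subtype.comp pa) (B.subtype.comp pb)
  have hβ : ∀ c d, β c d = hypBilin j (pa c) (pb d) := fun c d => rfl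
  have halt : ∀ c, β c c = 0 := by
    intro c
    refine hnt _ (pa c).2 _ (pb c).2 c c.2 ?_
    refine (congrArg (· + (c : (Fin j → ZMod 2) × (Fin j → ZMod 2))) (hdec' c)).trans ?_
    ext i
    · exact CharTwo.add_self_eq_zero _
    · exact CharTwo.add_self_eq_zero _
  have hleft : ∀ c, (∀ d, β c d = 0) → c = 0 := by
    intro c hc
    have h0 : (pa c : (Fin j → ZMod 2) × (Fin j → ZMod 2)) = 0 := by
      apply hypBilin_left
      intro w
      rw [← hdec w, map_add]
      obtain ⟨d, hd⟩ := hsurj (B.projectionOnto A hcompl.symm w)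
      rw [← hd, ← hβ, hc, add_zero]
      exact hAiso _ (pa c).2 _ (Subtype.property _)
    have h1 := hdec' c
    rw [h0, zero_add] at h1
    have h2 : (c : (Fin j → ZMod 2) × (Fin j → ZMod 2)) ∈ B ⊓ C :=
      ⟨by rw [← h1]; exact (pb c).2, c.2⟩
    rw [hBC] at h2
    simpa using h2
  have hA : β.IsAlt := halt
  have hnd : β.Nondegenerate :=
    ⟨hleft, fun d hd => hleft d fun c => hA.isRefl c d (hd c)⟩
  rw [← hCdim]
  exact even_finrank_of_alt β halt hnd
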